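/- Let X be a real Banach space, C ⊆ X a nonempty closed convex set, and T : C → C a ρ-Lipschitz map with 1 < ρ < √2 + 1 admitting a fixed point. Fix x⁰ ∈ C, let β♭_ρ = (√2+1−ρ)/(ρ√2) and L = ρβ♭_ρ, so that the map T♭x = (1−β♭_ρ)x⁰ + β♭_ρ T x is an L-Lipschitz self-map of C with L < 1 and has a unique fixed point x♭ ∈ C. Then the ♭-opt-halpern iterates (x^n), given by R♭₀ = 1+ρ, β♭_n = B♭_ρ(R♭_{n−1}), R♭_n = V♭_ρ(R♭_{n−1}), x^n = (1−β♭_n)x⁰ + β♭_n T x^{n−1}, satisfy ‖x^n − x♭‖ ≤ ‖x⁰ − x♭‖·(n+1)·L^n for all n ∈ ℕ; in particular x^n converges to x♭. -/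

import Mathlib

/-- `V♭_ρ(r) = min_{β ∈ [0,1]} ((1+ρ) - (1+3ρ)β + 2ρβ² + ρβr)`. -/
noncomputable def Vflat (ρ r : ℝ) : ℝ :=
  sInf ((fun b : ℝ => (1 + ρ) - (1 + 3 * ρ) * b + 2 * ρ * b ^ 2 + ρ * b * r) '' Set.Icc 0 1)

/-- `B♭_ρ(r)`: the minimizer of the quadratic over `[0,1]`. -/
noncomputable def Bflat (ρ r : ℝ) : ℝ :=
  if r ≤ 1 / ρ - 1 then 1 else if r ≤ 1 / ρ + 3 then (1 / ρ + 3 - r) / 4 else 0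

/-- The ♭-opt-halpern bounds: `R♭₀ = 1 + ρ`, `R♭_n = V♭_ρ(R♭_{n-1})`. -/
noncomputable def RflStar (ρ : ℝ) : ℕ → ℝ
  | 0 => 1 + ρ
  | n + 1 => Vflat ρ (RflStar ρ n)

theorem Bflat_sub_four_mul {ρ b : ℝ} (hb0 : 0 ≤ b) (hb1 : b ≤ 1) :
    Bflat ρ (1 / ρ + 3 - 4 * b) = b := by
  unfold Bflat
  split_ifs with h₁ h₂ <;> linarith

theorem Vflat_sub_four_mul {ρ b : ℝ} (hρ : 0 < ρ) (hb0 : 0 ≤ b) (hb1 : b ≤ 1) :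
    Vflat ρ (1 / ρ + 3 - 4 * b) = 1 + ρ - 2 * ρ * b ^ 2 := by
  have hinv : ρ * (1 / ρ) = 1 := mul_one_div_cancel hρ.ne'
  refine IsLeast.csInf_eq ⟨⟨b, ⟨hb0, hb1⟩, ?_⟩, ?_⟩
  · linear_combination b * hinv
  · rintro _ ⟨t, -, rfl⟩
    have h : 0 ≤ 2 * ρ * (t - b) ^ 2 := by positivity
    have h' : (1 + ρ) - (1 + 3 * ρ) * t + 2 * ρ * t ^ 2 + ρ * t * (1 / ρ + 3 - 4 * b)
        = 1 + ρ - 2 * ρ * b ^ 2 + 2 * ρ * (t - b) ^ 2 := by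
      linear_combination t * hinv
    simp only [h']
    linarith

/-- The step sizes increase geometrically to a root `β` of `2 (1 - ρ β)² = (ρ - 1)²`. -/
theorem exists_RflStar_eq {ρ β : ℝ} (hρ : 1 < ρ) (hβ0 : 0 < β) (hL : ρ * β < 1)
    (hroot : 2 * (1 - ρ * β) ^ 2 = (ρ - 1) ^ 2) (n : ℕ) :
    ∃ b, 0 ≤ b ∧ b ≤ β ∧ β - b ≤ β * (ρ * β) ^ (n + 1) ∧
      RflStar ρ n = 1 / ρ + 3 - 4 * b := by
  have hρ0 : 0 < ρ := by linarith
  have hinv : ρ * (1 / ρ) = 1 := mul_one_div_cancel hρ0.ne'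
  have hβ : 1 / ρ + 2 - ρ + 2 * ρ * β ^ 2 = 4 * β := by
    apply mul_left_cancel₀ hρ0.ne'
    linear_combination hroot + hinv
  have hβ1 : β ≤ 1 := by nlinarith
  have hLβ : ρ * β ^ 2 ≤ β := by nlinarith
  induction n with
  | zero =>
    refine ⟨(1 / ρ + 2 - ρ) / 4, by linarith, ?_, ?_, ?_⟩
    · have : 0 ≤ ρ * β ^ 2 := by positivity
      linarith
    · have : 0 ≤ ρ * β ^ 2 := by positivity
      rw [zero_add, pow_one]
      nlinarith
    · rw [RflStar]
      ring
  | succ n ih =>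
    obtain ⟨b, hb0, hbβ, hdist, hR⟩ := ih
    have hgap : β - (1 / ρ + 2 - ρ + 2 * ρ * b ^ 2) / 4 = ρ * ((β - b) * (β + b)) / 2 := by
      linear_combination -hβ / 4
    have hnonneg : 0 ≤ ρ * ((β - b) * (β + b)) :=
      mul_nonneg hρ0.le (mul_nonneg (by linarith) (by linarith))
    refine ⟨(1 / ρ + 2 - ρ + 2 * ρ * b ^ 2) / 4, ?_, by linarith, ?_, ?_⟩
    · have : 0 ≤ ρ * b ^ 2 := by positivity
      linarith
    · calc β - (1 / ρ + 2 - ρ + 2 * ρ * b ^ 2) / 4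
          = ρ * ((β - b) * (β + b)) / 2 := hgap
        _ ≤ ρ * β * (β - b) := by
          have : 0 ≤ ρ * (β - b) ^ 2 := by positivity
          nlinarith
        _ ≤ ρ * β * (β * (ρ * β) ^ (n + 1)) := by gcongr
        _ = β * (ρ * β) ^ (n + 1 + 1) := by ring
    · rw [RflStar, hR, Vflat_sub_four_mul hρ0 hb0 (hbβ.trans hβ1)]
      ring

theorem IsClosed.exists_fixedPoint_of_norm_sub_le {X : Type*} [NormedAddCommGroup X]
    [CompleteSpace X] {C : Set X} (hC : IsClosed C) (hne : C.Nonempty) {f : X → X}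
    (hf : Set.MapsTo f C C) {L : ℝ} (hL0 : 0 ≤ L) (hL1 : L < 1)
    (hlip : ∀ y ∈ C, ∀ z ∈ C, ‖f y - f z‖ ≤ L * ‖y - z‖) :
    ∃ p ∈ C, f p = p := by
  obtain ⟨x, hx⟩ := hne
  have hcontr : ContractingWith ⟨L, hL0⟩ (hf.restrict f C C) := by
    refine ⟨by exact_mod_cast hL1, LipschitzWith.of_dist_le_mul fun y z => ?_⟩
    rw [Subtype.dist_eq, Subtype.dist_eq, dist_eq_norm, dist_eq_norm]
    exact hlip y y.2 z z.2
  obtain ⟨p, hp, hfp, -⟩ :=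
    hcontr.exists_fixedPoint' hC.isComplete hf hx (edist_ne_top _ _)
  exact ⟨p, hp, hfp⟩

theorem norm_halpern_sub_le {X : Type*} [NormedAddCommGroup X] [NormedSpace ℝ X]
    {a u v p : X} {b β ρ : ℝ} (hβ : 0 < β) (hb0 : 0 ≤ b) (hbβ : b ≤ β)
    (hlip : ‖u - v‖ ≤ ρ * ‖p - ((1 - β) • a + β • v)‖) :
    β * ‖((1 - b) • a + b • u) - ((1 - β) • a + β • v)‖ ≤
      (β - b) * ‖a - ((1 - β) • a + β • v)‖ +
        β * b * ρ * ‖p - ((1 - β) • a + β • v)‖ := by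
  have hsplit : ((1 - b) • a + b • u) - ((1 - β) • a + β • v) =
      (β - b) • (a - v) + b • (u - v) := by module
  have ha : a - ((1 - β) • a + β • v) = β • (a - v) := by module
  rw [hsplit, ha, norm_smul, Real.norm_of_nonneg hβ.le]
  have h : ‖(β - b) • (a - v) + b • (u - v)‖ ≤ (β - b) * ‖a - v‖ + b * ‖u - v‖ := by
    refine (norm_add_le _ _).trans_eq ?_
    rw [norm_smul, norm_smul, Real.norm_of_nonneg hb0, Real.norm_of_nonneg (sub_nonneg.2 hbβ)]
  calc _ ≤ β * ((β - b) * ‖a - v‖ + b * ‖u - v‖) := by gcongr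
    _ ≤ β * ((β - b) * ‖a - v‖ + b * (ρ * ‖p - ((1 - β) • a + β • v)‖)) := by gcongr
    _ = _ := by ring

/-- in a real Banach space, for a `ρ`-Lipschitz self-map of a nonempty closed
convex set `C` with `1 < ρ < √2 + 1` admitting a fixed point, with
`β♭_ρ = (√2+1-ρ)/(ρ√2)` and `L = ρ β♭_ρ`, the map `T♭ x = (1-β♭_ρ) x⁰ + β♭_ρ T x` is an
`L`-Lipschitz self-map of `C` with `L < 1` and a unique fixed point `x♭ ∈ C`, and the
♭-opt-halpern iterates satisfy `‖x^n - x♭‖ ≤ ‖x⁰ - x♭‖ (n+1) Lⁿ`; in particular `x^n → x♭`. -/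
theorem flat_opt_halpern_converges
    {X : Type*} [NormedAddCommGroup X] [NormedSpace ℝ X] [CompleteSpace X]
    {C : Set X} (hCne : C.Nonempty) (hCclosed : IsClosed C) (hCconv : Convex ℝ C)
    {ρ : ℝ} (hρ1 : 1 < ρ) (hρ2 : ρ < Real.sqrt 2 + 1)
    {T : X → X} (hTmaps : Set.MapsTo T C C)
    (hTlip : ∀ x ∈ C, ∀ y ∈ C, ‖T x - T y‖ ≤ ρ * ‖x - y‖)
    (hfix : ∃ p ∈ C, T p = p)
    (x : ℕ → X) (hx0 : x 0 ∈ C)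
    (hx : ∀ n : ℕ, x (n + 1) =
      (1 - Bflat ρ (RflStar ρ n)) • x 0 + Bflat ρ (RflStar ρ n) • T (x n)) :
    (ρ * ((Real.sqrt 2 + 1 - ρ) / (ρ * Real.sqrt 2)) < 1) ∧
    (∀ y ∈ C, (1 - (Real.sqrt 2 + 1 - ρ) / (ρ * Real.sqrt 2)) • x 0 +
      ((Real.sqrt 2 + 1 - ρ) / (ρ * Real.sqrt 2)) • T y ∈ C) ∧
    (∀ y ∈ C, ∀ z ∈ C,
      ‖((1 - (Real.sqrt 2 + 1 - ρ) / (ρ * Real.sqrt 2)) • x 0 +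
          ((Real.sqrt 2 + 1 - ρ) / (ρ * Real.sqrt 2)) • T y) -
        ((1 - (Real.sqrt 2 + 1 - ρ) / (ρ * Real.sqrt 2)) • x 0 +
          ((Real.sqrt 2 + 1 - ρ) / (ρ * Real.sqrt 2)) • T z)‖ ≤
        (ρ * ((Real.sqrt 2 + 1 - ρ) / (ρ * Real.sqrt 2))) * ‖y - z‖) ∧
    ∃ xb ∈ C,
      ((1 - (Real.sqrt 2 + 1 - ρ) / (ρ * Real.sqrt 2)) • x 0 +
        ((Real.sqrt 2 + 1 - ρ) / (ρ * Real.sqrt 2)) • T xb = xb) ∧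
      (∀ y ∈ C, (1 - (Real.sqrt 2 + 1 - ρ) / (ρ * Real.sqrt 2)) • x 0 +
        ((Real.sqrt 2 + 1 - ρ) / (ρ * Real.sqrt 2)) • T y = y → y = xb) ∧
      (∀ n : ℕ, ‖x n - xb‖ ≤ ‖x 0 - xb‖ * ((n : ℝ) + 1) *
        (ρ * ((Real.sqrt 2 + 1 - ρ) / (ρ * Real.sqrt 2))) ^ n) ∧
      Filter.Tendsto x Filter.atTop (nhds xb) := by
  have hs0 : 0 < Real.sqrt 2 := by positivity
  have hρ0 : 0 < ρ := by linarith
  set β := (Real.sqrt 2 + 1 - ρ) / (ρ * Real.sqrt 2) with hβ_def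
  have hβ0 : 0 < β := div_pos (by linarith) (by positivity)
  have hLs : Real.sqrt 2 * (1 - ρ * β) = ρ - 1 := by
    rw [hβ_def]
    field_simp
    ring
  have hroot : 2 * (1 - ρ * β) ^ 2 = (ρ - 1) ^ 2 := by
    rw [← hLs, mul_pow, Real.sq_sqrt (by norm_num)]
  clear_value β
  have hL1 : ρ * β < 1 := by
    have : 0 < Real.sqrt 2 * (1 - ρ * β) := by linarith
    linarith [pos_of_mul_pos_right this hs0.le]
  have hL0 : 0 < ρ * β := by positivity
  have hβ1 : β ≤ 1 := by nlinarith
  have hmaps : ∀ b : ℝ, 0 ≤ b → b ≤ 1 → ∀ y ∈ C, (1 - b) • x 0 + b • T y ∈ C :=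
    fun b hb0 hb1 y hy => hCconv hx0 (hTmaps hy) (by linarith) hb0 (by ring)
  have hlip : ∀ y ∈ C, ∀ z ∈ C,
      ‖((1 - β) • x 0 + β • T y) - ((1 - β) • x 0 + β • T z)‖ ≤ (ρ * β) * ‖y - z‖ := by
    intro y hy z hz
    rw [add_sub_add_left_eq_sub, ← smul_sub, norm_smul, Real.norm_of_nonneg hβ0.le]
    calc β * ‖T y - T z‖ ≤ β * (ρ * ‖y - z‖) := by gcongr; exact hTlip y hy z hz
      _ = _ := by ring
  obtain ⟨p, hp, hfp⟩ := hCclosed.exists_fixedPoint_of_norm_sub_le hCne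
    (hmaps β hβ0.le hβ1) hL0.le hL1 hlip
  have hbound : ∀ n : ℕ, x n ∈ C ∧ ‖x n - p‖ ≤ ‖x 0 - p‖ * ((n : ℝ) + 1) * (ρ * β) ^ n := by
    intro n
    induction n with
    | zero => exact ⟨hx0, by simp⟩
    | succ n ih =>
      obtain ⟨hxn, hn⟩ := ih
      obtain ⟨b, hb0, hbβ, hdist, hR⟩ := exists_RflStar_eq hρ1 hβ0 hL1 hroot n
      have hb1 := hbβ.trans hβ1
      have hx' := hx n
      rw [hR, Bflat_sub_four_mul hb0 hb1] at hx'
      refine ⟨hx' ▸ hmaps b hb0 hb1 _ hxn, ?_⟩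
      have hstep := norm_halpern_sub_le (a := x 0) (u := T (x n)) (v := T p) (p := x n) (ρ := ρ)
        hβ0 hb0 hbβ (by rw [hfp]; exact hTlip _ hxn _ hp)
      rw [hfp, ← hx'] at hstep
      refine le_of_mul_le_mul_left ?_ hβ0
      calc β * ‖x (n + 1) - p‖
          ≤ (β - b) * ‖x 0 - p‖ + β * b * ρ * ‖x n - p‖ := hstep
        _ ≤ β * (ρ * β) ^ (n + 1) * ‖x 0 - p‖ +
            β * β * ρ * (‖x 0 - p‖ * ((n : ℝ) + 1) * (ρ * β) ^ n) := by gcongr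
        _ = β * (‖x 0 - p‖ * (((n + 1 : ℕ) : ℝ) + 1) * (ρ * β) ^ (n + 1)) := by
          push_cast
          ring
  refine ⟨hL1, hmaps β hβ0.le hβ1, hlip, p, hp, hfp, fun y hy hfy => ?_,
    fun n => (hbound n).2, ?_⟩
  · have h := hlip y hy p hp
    rw [hfy, hfp] at h
    have : ‖y - p‖ ≤ 0 := by nlinarith [norm_nonneg (y - p)]
    exact sub_eq_zero.1 (norm_le_zero_iff.1 this)
  · refine tendsto_iff_norm_sub_tendsto_zero.2
      (squeeze_zero (fun _ => norm_nonneg _) (fun n => (hbound n).2) ?_)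
    have hlin := tendsto_self_mul_const_pow_of_lt_one hL0.le hL1
    have hgeom := tendsto_pow_atTop_nhds_zero_of_lt_one hL0.le hL1
    simpa [add_mul, mul_assoc] using (hlin.add hgeom).const_mul ‖x 0 - p‖
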